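/- arXiv:2501.02679 — 2 statements merged into one kernel-verified Lean document; each statement's English description precedes it below -/
import Mathlib

section
/- Let N be an L-structure, A ⊆ N a set of parameters, (b_i)_{i<α} a construction sequence over A in N, and M an elementary substructure of N with A ⊆ M. Then there is an elementary map f : A ∪ {b_i : i < α} → M (with respect to formulas evaluated in N) that fixes A pointwise. -/
open FirstOrder FirstOrder.Language Set

universe u v w

/-- `b ≡_A b'`: the tuples `b` and `b'` satisfy the same first-order `L`-formulas with
parameters from `A` in `M`. -/
def SameType (L : FirstOrder.Language.{u, v}) {M : Type w} [L.Structure M] (A : Set M)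
    {ι : Type*} (b b' : ι → M) : Prop :=
  ∀ (m : ℕ) (φ : L.Formula (ι ⊕ Fin m)) (p : Fin m → M), (∀ k, p k ∈ A) →
    (φ.Realize (Sum.elim b p) ↔ φ.Realize (Sum.elim b' p))

/-- The formula `φ` with parameters `p` isolates the type of the tuple `b` over the
parameter set `P`. -/
def Isolates {L : FirstOrder.Language.{u, v}} {M : Type w} [L.Structure M] {ι : Type*} {m : ℕ}
    (φ : L.Formula (ι ⊕ Fin m)) (p : Fin m → M) (P : Set M) (b : ι → M) : Prop :=
  φ.Realize (Sum.elim b p) ∧ ∀ c : ι → M, φ.Realize (Sum.elim c p) → SameType L P c b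

/-- The type `tp(b/P)` is isolated: some formula with parameters from `P` isolates it. -/
def IsolatedType (L : FirstOrder.Language.{u, v}) {M : Type w} [L.Structure M] (P : Set M)
    {ι : Type*} (b : ι → M) : Prop :=
  ∃ (m : ℕ) (φ : L.Formula (ι ⊕ Fin m)) (p : Fin m → M),
    (∀ k, p k ∈ P) ∧ Isolates φ p P b

/-- `(b_i)` is a construction sequence over `A`: each `tp(b_i / A ∪ {b_j : j < i})` is
isolated. -/
def IsConstructionSequence (L : FirstOrder.Language.{u, v}) {M : Type w} [L.Structure M]
    (A : Set M) {ι : Type*} [LinearOrder ι] (b : ι → M) : Prop :=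
  ∀ i : ι, IsolatedType L (A ∪ b '' {j | j < i}) ![b i]

/-- `B ⫛^wo_A C`: the tuples `B` and `C` are weakly orthogonal over `A`. -/
def WeaklyOrthogonal (L : FirstOrder.Language.{u, v}) {M : Type w} [L.Structure M] (A : Set M)
    {ιB ιC : Type*} (B : ιB → M) (C : ιC → M) : Prop :=
  ∀ (B' : ιB → M) (C' : ιC → M), SameType L A B' B → SameType L A C' C →
    SameType L A (Sum.elim B' C') (Sum.elim B C)

/-- `f` is an elementary map on the subset `S` of `M`. -/
def IsElementaryMapOn (L : FirstOrder.Language.{u, v}) {M : Type w} [L.Structure M]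
    (S : Set M) (f : M → M) : Prop :=
  ∀ (n : ℕ) (φ : L.Formula (Fin n)) (a : Fin n → M), (∀ k, a k ∈ S) →
    (φ.Realize a ↔ φ.Realize (f ∘ a))

/-- `M` is strongly homogeneous: any two tuples with the same type over a set of parameters
are conjugate by an automorphism fixing those parameters pointwise. -/
def StronglyHomogeneous (L : FirstOrder.Language.{u, v}) (M : Type w) [L.Structure M] : Prop :=
  ∀ (P : Set M) (ι : Type w) (x y : ι → M), SameType L P x y →
    ∃ σ : M ≃[L] M, (∀ a ∈ P, σ a = a) ∧ ∀ i, σ (x i) = y i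

namespace SameType

variable {L : FirstOrder.Language.{u, v}} {N : Type w} [L.Structure N]

theorem realize_iff {P : Set N} {ι κ : Type*} [Finite κ] {b b' : ι → N}
    (h : SameType L P b b') (φ : L.Formula (ι ⊕ κ)) (p : κ → N) (hp : ∀ k, p k ∈ P) :
    φ.Realize (Sum.elim b p) ↔ φ.Realize (Sum.elim b' p) := by
  obtain ⟨n, ⟨e⟩⟩ := Finite.exists_equiv_fin κ
  have := h n (φ.relabel (Sum.map id e)) (p ∘ e.symm) fun k => hp _
  simpa [Formula.realize_relabel, Sum.elim_comp_map, Function.comp_assoc] using this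

end SameType

/-- A binary relation on a structure is elementary if related finite tuples satisfy the same
formulas. -/
def IsElementaryRel (L : FirstOrder.Language.{u, v}) {N : Type w} [L.Structure N]
    (R : Set (N × N)) : Prop :=
  ∀ (n : ℕ) (φ : L.Formula (Fin n)) (a : Fin n → N × N), (∀ k, a k ∈ R) →
    (φ.Realize (fun k => (a k).1) ↔ φ.Realize (fun k => (a k).2))

namespace IsElementaryRel

variable {L : FirstOrder.Language.{u, v}} {N : Type w} [L.Structure N] {R : Set (N × N)}

theorem realize_iff (hR : IsElementaryRel L R) {κ : Type*} [Finite κ] (φ : L.Formula κ)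
    {x y : κ → N} (hxy : ∀ k, (x k, y k) ∈ R) : φ.Realize x ↔ φ.Realize y := by
  obtain ⟨n, ⟨e⟩⟩ := Finite.exists_equiv_fin κ
  have := hR n (φ.relabel e) (fun k => (x (e.symm k), y (e.symm k))) fun k => hxy _
  simpa [Formula.realize_relabel, Function.comp_def] using this

theorem of_imp (h : ∀ (n : ℕ) (φ : L.Formula (Fin n)) (a : Fin n → N × N), (∀ k, a k ∈ R) →
    φ.Realize (fun k => (a k).1) → φ.Realize (fun k => (a k).2)) : IsElementaryRel L R := by
  intro n φ a ha
  refine ⟨h n φ a ha, fun h₂ => ?_⟩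
  by_contra h₁
  exact h n φ.not a ha h₁ h₂

theorem eq_of_mem (hR : IsElementaryRel L R) {x y z : N} (hy : (x, y) ∈ R) (hz : (x, z) ∈ R) :
    y = z := by
  have := hR.realize_iff (Term.equal (L := L) (Term.var (0 : Fin 2)) (Term.var 1))
    (x := ![x, x]) (y := ![y, z]) (by simp [Fin.forall_fin_two, hy, hz])
  simpa [Formula.realize_equal] using this

theorem diagonal (A : Set N) : IsElementaryRel L {x : N × N | x.1 ∈ A ∧ x.2 = x.1} := by
  intro n φ a ha
  rw [show (fun k => (a k).2) = fun k => (a k).1 from funext fun k => (ha k).2]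

theorem sUnion {c : Set (Set (N × N))} (hne : c.Nonempty) (hchain : IsChain (· ⊆ ·) c)
    (hc : ∀ R ∈ c, IsElementaryRel L R) : IsElementaryRel L (⋃₀ c) := by
  intro n φ a ha
  obtain ⟨R, hRc, hR⟩ := DirectedOn.exists_mem_subset_of_finite_of_subset_sUnion hne
    hchain.directedOn (Set.finite_range a) (Set.range_subset_iff.2 ha)
  exact hc R hRc n φ a fun k => hR ⟨k, rfl⟩

/-- An elementary relation extends to an element whose type over the domain is isolated, by any
element realizing the image of the isolating formula. -/
theorem insert (hR : IsElementaryRel L R) {P : Set N} (hP : ∀ z ∈ R, z.1 ∈ P) {m : ℕ}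
    {φ : L.Formula (Fin 1 ⊕ Fin m)} {p q : Fin m → N} (hpq : ∀ k, (p k, q k) ∈ R) {x y : N}
    (hx : Isolates φ p P ![x]) (hy : φ.Realize (Sum.elim ![y] q)) :
    IsElementaryRel L (insert (x, y) R) := by
  classical
  refine of_imp fun n ψ a ha hψ => ?_
  let K := {k : Fin n // a k ∈ R}
  let σ : Fin n → Fin 1 ⊕ K := fun k => if h : a k ∈ R then Sum.inr ⟨k, h⟩ else Sum.inl 0
  have hfst : Sum.elim ![x] (fun k : K => (a k).1) ∘ σ = fun k => (a k).1 := by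
    funext k
    rcases ha k with h | h <;> by_cases h' : a k ∈ R <;> simp_all [σ]
  have hsnd : Sum.elim ![y] (fun k : K => (a k).2) ∘ σ = fun k => (a k).2 := by
    funext k
    rcases ha k with h | h <;> by_cases h' : a k ∈ R <;> simp_all [σ]
  let χ : L.Formula ((Fin m ⊕ K) ⊕ Fin 1) :=
    (φ.relabel (Sum.elim Sum.inr (Sum.inl ∘ Sum.inl))).imp
      ((ψ.relabel σ).relabel (Sum.elim Sum.inr (Sum.inl ∘ Sum.inr)))
  have hχ (v : Fin m → N) (w : K → N) : (χ.iAlls (Fin 1)).Realize (Sum.elim v w) ↔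
      ∀ d : Fin 1 → N, φ.Realize (Sum.elim d v) → (ψ.relabel σ).Realize (Sum.elim d w) := by
    rw [Formula.realize_iAlls]
    refine forall_congr' fun d => ?_
    rw [Formula.realize_imp, Formula.realize_relabel, Formula.realize_relabel]
    simp only [Sum.comp_elim, ← Function.comp_assoc]
    rfl
  have hdom : (χ.iAlls (Fin 1)).Realize (Sum.elim p fun k : K => (a k).1) := by
    refine (hχ _ _).2 fun d hd => ?_
    rw [(hx.2 d hd).realize_iff _ _ fun k : K => hP _ k.2, Formula.realize_relabel, hfst]
    exact hψ
  rw [hR.realize_iff _ (y := Sum.elim q fun k : K => (a k).2)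
    (by rintro (k | k); exacts [hpq k, k.2]), hχ] at hdom
  have := hdom _ hy
  rwa [Formula.realize_relabel, hsnd] at this

/-- An elementary relation with values in an elementary substructure extends, with values in that
substructure, to an element whose type over the domain is isolated. -/
theorem exists_insert (hR : IsElementaryRel L R) {P : Set N} (hP : ∀ z, z ∈ P ↔ ∃ y, (z, y) ∈ R)
    (M : L.ElementarySubstructure N) (hM : ∀ z ∈ R, z.2 ∈ M) {x : N}
    (hx : IsolatedType L P ![x]) : ∃ y ∈ M, IsElementaryRel L (Insert.insert (x, y) R) := by
  obtain ⟨m, φ, p, hp, hφ⟩ := hx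
  choose q hq using fun k => (hP _).1 (hp k)
  let θ : L.Formula (Fin m) := (φ.relabel Sum.swap).iExs (Fin 1)
  have hθ : θ.Realize q := by
    rw [← hR.realize_iff θ hq, Formula.realize_iExs]
    exact ⟨![x], by simpa [Formula.realize_relabel] using hφ.1⟩
  let q' : Fin m → M := fun k => ⟨q k, hM _ (hq k)⟩
  have hθ' : θ.Realize q' := (M.subtype.map_formula θ q').1 hθ
  obtain ⟨d, hd⟩ := Formula.realize_iExs.1 hθ'
  refine ⟨d 0, (d 0).2, hR.insert (fun z hz => (hP _).2 ⟨_, hz⟩) hq hφ ?_⟩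
  rw [← M.subtype.map_formula, Formula.realize_relabel] at hd
  convert hd using 1
  funext k
  rcases k with k | k
  · fin_cases k; rfl
  · rfl

end IsElementaryRel

/-- For a construction sequence `(b_i)` over `A` in `N` and an elementary
substructure `M ⊇ A`, there is an elementary map `f : A ∪ {b_i} → M` fixing `A` pointwise. -/
theorem construction_sequence_embeds_into_model
    {L : FirstOrder.Language.{u, v}} {N : Type w} [L.Structure N]
    (A : Set N) {ι : Type*} [LinearOrder ι] [WellFoundedLT ι]
    (b : ι → N) (hb : IsConstructionSequence L A b)
    (M : L.ElementarySubstructure N) (hA : A ⊆ (M : Set N)) :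
    ∃ f : N → N, (∀ x ∈ A ∪ Set.range b, f x ∈ M) ∧
      IsElementaryMapOn L (A ∪ Set.range b) f ∧ ∀ a ∈ A, f a = a := by
  let S : Set (Set (N × N)) := {R | IsElementaryRel L R ∧ (∀ z ∈ R, z.2 ∈ M) ∧
    ∀ z ∈ R, z.1 ∈ A ∨ ∃ i, b i = z.1 ∧ ∀ j < i, ∃ y, (b j, y) ∈ R}
  have hS : ∀ c ⊆ S, IsChain (· ⊆ ·) c → c.Nonempty → ∃ U ∈ S, ∀ R ∈ c, R ⊆ U := by
    intro c hc hchain hne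
    refine ⟨⋃₀ c, ⟨.sUnion hne hchain fun R hR => (hc hR).1, ?_, ?_⟩,
      fun R hR => Set.subset_sUnion_of_mem hR⟩
    · rintro z ⟨R, hR, hz⟩
      exact (hc hR).2.1 z hz
    · rintro z ⟨R, hR, hz⟩
      exact ((hc hR).2.2 z hz).imp_right fun ⟨i, hi, hlt⟩ =>
        ⟨i, hi, fun j hj => (hlt j hj).imp fun _ h => ⟨R, hR, h⟩⟩
  obtain ⟨R, hAR, hmax⟩ := zorn_subset_nonempty S hS {x : N × N | x.1 ∈ A ∧ x.2 = x.1}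
    ⟨IsElementaryRel.diagonal A, fun z hz => hz.2 ▸ hA hz.1, fun z hz => Or.inl hz.1⟩
  obtain ⟨hR, hRM, hdom⟩ := hmax.prop
  have htotal (i : ι) : ∃ y, (b i, y) ∈ R := by
    induction i using WellFoundedLT.induction with | _ i ih
    by_contra hi
    have hP (z : N) : z ∈ A ∪ b '' {j | j < i} ↔ ∃ y, (z, y) ∈ R := by
      constructor
      · rintro (hz | ⟨j, hj, rfl⟩)
        exacts [⟨z, hAR ⟨hz, rfl⟩⟩, ih j hj]
      · rintro ⟨y, hy⟩
        refine (hdom _ hy).imp_right ?_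
        rintro ⟨j, hj, hlt⟩
        refine ⟨j, lt_of_not_ge fun hij => hi ?_, hj⟩
        rcases hij.eq_or_lt with rfl | hij
        exacts [⟨y, by rwa [hj]⟩, hlt i hij]
    obtain ⟨y, hyM, hy⟩ := hR.exists_insert hP M hRM (hb i)
    have hmem : insert (b i, y) R ∈ S := by
      refine ⟨hy, Set.forall_mem_insert.2 ⟨hyM, hRM⟩, Set.forall_mem_insert.2 ⟨?_, ?_⟩⟩
      · exact Or.inr ⟨i, rfl, fun j hj => (ih j hj).imp fun _ => Or.inr⟩
      · exact fun z hz => (hdom z hz).imp_right fun ⟨j, hj, hlt⟩ =>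
          ⟨j, hj, fun k hk => (hlt k hk).imp fun _ => Or.inr⟩
    exact hi ⟨y, hmax.le_of_ge hmem (Set.subset_insert _ _) (Set.mem_insert _ _)⟩
  have hex (x : N) : ∃ y, x ∈ A ∪ Set.range b → (x, y) ∈ R := by
    by_cases hx : x ∈ A ∪ Set.range b
    · rcases hx with hx | ⟨i, rfl⟩
      exacts [⟨x, fun _ => hAR ⟨hx, rfl⟩⟩, (htotal i).imp fun _ h _ => h]
    · exact ⟨x, fun h => absurd h hx⟩
  choose f hf using hex
  exact ⟨f, fun x hx => hRM _ (hf x hx),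
    fun n φ a ha => hR.realize_iff φ fun k => hf _ (ha k),
    fun a ha => hR.eq_of_mem (hf a (Or.inl ha)) (hAR ⟨ha, rfl⟩)⟩
end

section
/- Let M be a strongly homogeneous L-structure, A ⊆ M, and (b_i)_{i<α} a construction sequence over A in M, where for each i < α the formula φ_i isolates tp(b_i / A ∪ {b_j : j < i}) and the parameters of φ_i lie in A ∪ {b_j : j ∈ C_i} for some set C_i ⊆ i. Let X ⊆ α be construction-closed, i.e., C_i ⊆ X for every i ∈ X. Then for every i ∈ α∖X, the same formula φ_i isolates tp(b_i / A ∪ {b_j : j ∈ X} ∪ {b_j : j < i, j ∉ X}); in particular, the subsequence (b_i)_{i∈α∖X}, taken in increasing order of index, is a construction sequence over A ∪ {b_j : j ∈ X}. -/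
open FirstOrder FirstOrder.Language Set

universe u v w

namespace SameType

variable {L : FirstOrder.Language.{u, v}} {M : Type w} [L.Structure M] {P Q : Set M}
  {ι κ : Type*} {x y : ι → M}

theorem mono (h : SameType L Q x y) (hPQ : P ⊆ Q) : SameType L P x y :=
  fun m φ p hp => h m φ p fun k => hPQ (hp k)

theorem comp (h : SameType L P x y) (f : κ → ι) : SameType L P (x ∘ f) (y ∘ f) := by
  intro m φ p hp
  have := h m (φ.relabel (Sum.map f id)) p hp
  simpa only [Formula.realize_relabel, Sum.elim_comp_map, Function.comp_id] using this

theorem of_equiv (σ : M ≃[L] M) (hP : ∀ a ∈ P, σ a = a) (hxy : ∀ i, σ (x i) = y i) :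
    SameType L P x y := by
  intro m φ p hp
  have hσ : (σ ∘ Sum.elim x p : ι ⊕ Fin m → M) = Sum.elim y p := by
    ext (i | k)
    · exact hxy i
    · exact hP _ (hp k)
  rw [← hσ, StrongHomClass.realize_formula σ]

/-- Agreement of types over a union indexed by a linear order can be checked on initial
segments, since a formula has only finitely many parameters. -/
theorem union_image_of_initial {α : Type*} [LinearOrder α] {b : α → M} {S : Set α}
    (h₀ : SameType L P x y) (h : ∀ k ∈ S, SameType L (P ∪ b '' {j | j ∈ S ∧ j ≤ k}) x y) :
    SameType L (P ∪ b '' S) x y := by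
  intro m φ p hp
  by_cases hall : ∀ k, p k ∈ P
  · exact h₀ m φ p hall
  push Not at hall
  obtain ⟨k₀, hk₀⟩ := hall
  have hidx : ∀ k, ∃ j ∈ S, p k ∈ P ∨ b j = p k := by
    obtain ⟨j₀, hj₀, -⟩ := (hp k₀).resolve_left hk₀
    intro k
    rcases hp k with hk | ⟨j, hj, hjk⟩
    · exact ⟨j₀, hj₀, Or.inl hk⟩
    · exact ⟨j, hj, Or.inr hjk⟩
  choose j hjS hj using hidx
  have : Nonempty (Fin m) := ⟨k₀⟩
  obtain ⟨l, hl⟩ := Finite.exists_max j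
  refine h (j l) (hjS l) m φ p fun k => ?_
  rcases hj k with hk | hk
  · exact Or.inl hk
  · exact Or.inr ⟨j k, ⟨hjS k, hl k⟩, hk⟩

end SameType

theorem Isolates.realize_equiv {L : FirstOrder.Language.{u, v}} {M : Type w} [L.Structure M]
    {ι : Type*} {m : ℕ} {φ : L.Formula (ι ⊕ Fin m)} {p : Fin m → M} {P : Set M} {b : ι → M}
    (h : Isolates φ p P b) (σ : M ≃[L] M) (hp : ∀ k, σ (p k) = p k) :
    SameType L P (σ ∘ b) b := by
  refine h.2 _ ?_
  have hσ : (σ ∘ Sum.elim b p : ι ⊕ Fin m → M) = Sum.elim (σ ∘ b) p := by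
    ext (i | k)
    · rfl
    · exact hp k
  rw [← hσ, StrongHomClass.realize_formula σ]
  exact h.1

/-- Strong homogeneity for finite tuples, regardless of universe levels. -/
theorem StronglyHomogeneous.exists_equiv {L : FirstOrder.Language.{u, v}} {M : Type w}
    [L.Structure M] (hM : StronglyHomogeneous L M) {P : Set M} {n : ℕ} {x y : Fin n → M}
    (h : SameType L P x y) :
    ∃ σ : M ≃[L] M, (∀ a ∈ P, σ a = a) ∧ ∀ i, σ (x i) = y i := by
  obtain ⟨σ, hP, hσ⟩ := hM P (ULift.{w} (Fin n)) _ _ (h.comp ULift.down)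
  exact ⟨σ, hP, fun i => hσ ⟨i⟩⟩

/-- If `d` is isolated over `Q` by a formula with parameters in `P ⊆ Q`, and the tuple `y`
lies in `Q`, then tuples with the type of `y` over `P` have the type of `y` over `P ∪ {d}`. -/
theorem SameType.insert_of_isolates {L : FirstOrder.Language.{u, v}} {M : Type w}
    [L.Structure M] (hM : StronglyHomogeneous L M) {P Q : Set M} {n m : ℕ} {x y : Fin n → M}
    {φ : L.Formula (Fin 1 ⊕ Fin m)} {p : Fin m → M} {d : M} (h : SameType L P x y)
    (hφ : Isolates φ p Q ![d]) (hp : ∀ k, p k ∈ P) (hPQ : P ⊆ Q) (hy : ∀ i, y i ∈ Q) :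
    SameType L (insert d P) x y := by
  obtain ⟨τ, hτP, hτ⟩ := hM.exists_equiv h
  obtain ⟨ρ, hρQ, hρ⟩ := hM.exists_equiv (hφ.realize_equiv τ fun k => hτP _ (hp k))
  refine SameType.of_equiv (ρ.comp τ) ?_ fun i => ?_
  · rintro a (rfl | ha)
    · simpa using hρ 0
    · rw [Equiv.comp_apply, hτP a ha, hρQ a (hPQ ha)]
  · rw [Equiv.comp_apply, hτ i, hρQ _ (hy i)]

/-- For a construction sequence with isolating formulas `φ_i` whose
parameters lie in `A ∪ {b_j : j ∈ C_i}` and a construction-closed `X ⊆ α`, each `φ_i` for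
`i ∉ X` still isolates `tp(b_i / A ∪ {b_j : j ∈ X} ∪ {b_j : j < i, j ∉ X})`; in particular
the subsequence `(b_i)_{i ∉ X}` is a construction sequence over `A ∪ {b_j : j ∈ X}`. -/
theorem construction_shuffle
    {L : FirstOrder.Language.{u, v}} {M : Type w} [L.Structure M]
    (hM : StronglyHomogeneous L M) (A : Set M)
    {ι : Type w} [LinearOrder ι] [WellFoundedLT ι] (b : ι → M)
    (m : ι → ℕ) (φ : ∀ i : ι, L.Formula (Fin 1 ⊕ Fin (m i))) (p : ∀ i : ι, Fin (m i) → M)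
    (Cs : ι → Set ι) (hCs : ∀ i : ι, Cs i ⊆ {j | j < i})
    (hiso : ∀ i : ι, Isolates (φ i) (p i) (A ∪ b '' {j | j < i}) ![b i])
    (hparam : ∀ (i : ι) (k : Fin (m i)), p i k ∈ A ∪ b '' Cs i)
    (X : Set ι) (hX : ∀ i ∈ X, Cs i ⊆ X) :
    (∀ i ∉ X, Isolates (φ i) (p i) (A ∪ b '' X ∪ b '' {j | j < i ∧ j ∉ X}) ![b i]) ∧
    IsConstructionSequence L (A ∪ b '' X) (fun i : {j : ι // j ∉ X} => b i) := by
  have hmain : ∀ i ∉ X,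
      Isolates (φ i) (p i) (A ∪ b '' X ∪ b '' {j | j < i ∧ j ∉ X}) ![b i] := by
    intro i hi
    refine ⟨(hiso i).1, fun c hc => ?_⟩
    have hbase : SameType L (A ∪ b '' {j | j < i}) c ![b i] := (hiso i).2 c hc
    have hinit : ∀ k, SameType L
        (A ∪ b '' {j | j < i} ∪ b '' {j | j ∈ X ∧ j ≤ k}) c ![b i] := by
      intro k
      induction k using WellFoundedLT.induction with
      | ind k ih =>
      have hlt : SameType L (A ∪ b '' {j | j < i} ∪ b '' {j | j ∈ X ∧ j < k}) c ![b i] :=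
        hbase.union_image_of_initial fun l hl => (ih l hl.2).mono
          (union_subset_union_right _ (image_mono fun j hj => ⟨hj.1.1, hj.2⟩))
      by_cases hk : k ∈ X ∧ i < k
      · refine (hlt.insert_of_isolates hM (hiso k) (fun l => ?_) ?_ fun l => ?_).mono ?_
        · rcases hparam k l with h | ⟨j, hj, hjl⟩
          · exact Or.inl (Or.inl h)
          · exact Or.inr ⟨j, ⟨hX k hk.1 hj, hCs k hj⟩, hjl⟩
        · rintro a ((ha | ⟨j, hj, rfl⟩) | ⟨j, hj, rfl⟩)
          · exact Or.inl ha
          · exact Or.inr ⟨j, lt_trans hj hk.2, rfl⟩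
          · exact Or.inr ⟨j, hj.2, rfl⟩
        · rw [Subsingleton.elim l 0]
          exact Or.inr ⟨i, hk.2, rfl⟩
        · rintro a (ha | ⟨j, ⟨hjX, hjk⟩, rfl⟩)
          · exact Or.inr (Or.inl ha)
          · rcases hjk.eq_or_lt with rfl | hjk
            · exact Or.inl rfl
            · exact Or.inr (Or.inr ⟨j, ⟨hjX, hjk⟩, rfl⟩)
      · refine hlt.mono ?_
        rintro a (ha | ⟨j, ⟨hjX, hjk⟩, rfl⟩)
        · exact Or.inl ha
        · rcases hjk.eq_or_lt with rfl | hjk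
          · have hji : j < i := lt_of_le_of_ne (not_lt.1 fun h => hk ⟨hjX, h⟩)
              fun h => hi (h ▸ hjX)
            exact Or.inl (Or.inr ⟨j, hji, rfl⟩)
          · exact Or.inr ⟨j, ⟨hjX, hjk⟩, rfl⟩
    refine (hbase.union_image_of_initial (S := X) fun k _ => hinit k).mono ?_
    rintro a ((ha | ha) | ⟨j, hj, rfl⟩)
    · exact Or.inl (Or.inl ha)
    · exact Or.inr ha
    · exact Or.inl (Or.inr ⟨j, hj.1, rfl⟩)
  refine ⟨hmain, fun ⟨i, hi⟩ => ⟨m i, φ i, p i, fun k => ?_, ?_⟩⟩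
  · rcases hparam i k with h | ⟨j, hj, hjk⟩
    · exact Or.inl (Or.inl h)
    · by_cases hjX : j ∈ X
      · exact Or.inl (Or.inr ⟨j, hjX, hjk⟩)
      · exact Or.inr ⟨⟨j, hjX⟩, hCs i hj, hjk⟩
  · refine ⟨(hmain i hi).1, fun c hc => ((hmain i hi).2 c hc).mono ?_⟩
    rintro a (ha | ⟨j, hj, rfl⟩)
    · exact Or.inl ha
    · exact Or.inr ⟨j, ⟨hj, j.2⟩, rfl⟩
end
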